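/- Let A, B ∈ B(H). Then w(AB + BA) ≤ 2√2 · ‖B‖ · (w(A)⁴ − (1/4)c((Re(A²))²) − (1/2)|‖Re(A)‖⁴ − ‖Im(A)‖⁴|)^{1/4} and w(AB − BA) ≤ 2√2 · ‖B‖ · (w(A)⁴ − (1/4)c((Re(A²))²) − (1/2)|‖Re(A)‖⁴ − ‖Im(A)‖⁴|)^{1/4}. -/

import Mathlib

open ContinuousLinearMap Filter
open scoped ComplexInnerProductSpace Topology

variable {H : Type*} [NormedAddCommGroup H] [InnerProductSpace ℂ H]
  [CompleteSpace H] [Nontrivial H]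

/-- The numerical range of a bounded linear operator. -/
noncomputable def numRange (A : H →L[ℂ] H) : Set ℂ :=
  {z : ℂ | ∃ x : H, ‖x‖ = 1 ∧ z = ⟪x, A x⟫}

/-- The numerical radius of a bounded linear operator. -/
noncomputable def numRadius (A : H →L[ℂ] H) : ℝ :=
  sSup {r : ℝ | ∃ x : H, ‖x‖ = 1 ∧ r = ‖(⟪x, A x⟫)‖}

/-- The Crawford number of a bounded linear operator. -/
noncomputable def crawford (A : H →L[ℂ] H) : ℝ :=
  sInf {r : ℝ | ∃ x : H, ‖x‖ = 1 ∧ r = ‖(⟪x, A x⟫)‖}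

/-- The real part `(A + A*)/2` of a bounded linear operator. -/
noncomputable def reOp (A : H →L[ℂ] H) : H →L[ℂ] H :=
  (2 : ℂ)⁻¹ • (A + ContinuousLinearMap.adjoint A)

/-- The imaginary part `(A - A*)/(2i)` of a bounded linear operator. -/
noncomputable def imOp (A : H →L[ℂ] H) : H →L[ℂ] H :=
  (2 * Complex.I)⁻¹ • (A - ContinuousLinearMap.adjoint A)

set_option linter.unusedSectionVars false

theorem norm_inner_le_numRadius (A : H →L[ℂ] H) (x : H) :
    ‖⟪x, A x⟫‖ ≤ numRadius A * ‖x‖ ^ 2 := by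
  rcases eq_or_ne x 0 with rfl | hx
  · simp
  have hx0 : ‖x‖ ≠ 0 := norm_ne_zero_iff.mpr hx
  have hbdd : BddAbove {r : ℝ | ∃ y : H, ‖y‖ = 1 ∧ r = ‖(⟪y, A y⟫)‖} := by
    refine ⟨‖A‖, ?_⟩
    rintro r ⟨y, hy, rfl⟩
    calc ‖⟪y, A y⟫‖ ≤ ‖y‖ * ‖A y‖ := norm_inner_le_norm _ _
      _ ≤ ‖A‖ := by simpa [hy] using A.le_opNorm y
  have hunit : ‖((‖x‖ : ℂ)⁻¹ • x)‖ = 1 := by simp [norm_smul, hx0]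
  have h : _ ≤ numRadius A := le_csSup hbdd ⟨_, hunit, rfl⟩
  simp only [map_smul, inner_smul_left, inner_smul_right, norm_mul, norm_inv, map_inv₀,
    RCLike.norm_conj, Complex.norm_real, norm_norm] at h
  have hpos : 0 < ‖x‖ ^ 2 := by positivity
  rw [← div_le_iff₀ hpos]
  refine le_of_eq_of_le ?_ h
  field_simp

theorem numRadius_le {A : H →L[ℂ] H} {c : ℝ} (h : ∀ x : H, ‖x‖ = 1 → ‖⟪x, A x⟫‖ ≤ c) :
    numRadius A ≤ c := by
  obtain ⟨x, hx⟩ := exists_norm_eq H zero_le_one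
  refine csSup_le ⟨_, x, hx, rfl⟩ ?_
  rintro r ⟨y, hy, rfl⟩
  exact h y hy

theorem crawford_le (A : H →L[ℂ] H) {x : H} (hx : ‖x‖ = 1) : crawford A ≤ ‖⟪x, A x⟫‖ := by
  refine csInf_le ⟨0, ?_⟩ ⟨x, hx, rfl⟩
  rintro r ⟨y, -, rfl⟩
  exact norm_nonneg _

theorem isSelfAdjoint_reOp (A : H →L[ℂ] H) : IsSelfAdjoint (reOp A) := by
  simp [IsSelfAdjoint, reOp, star_eq_adjoint, add_comm]

theorem isSelfAdjoint_imOp (A : H →L[ℂ] H) : IsSelfAdjoint (imOp A) := by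
  simp only [IsSelfAdjoint, imOp, star_smul, star_sub, star_eq_adjoint, adjoint_adjoint]
  rw [← neg_sub A, smul_neg, ← neg_smul]
  simp

theorem norm_le_of_norm_inner_le {T : H →L[ℂ] H} (hT : IsSelfAdjoint T) {c : ℝ}
    (h : ∀ x : H, ‖⟪x, T x⟫‖ ≤ c * ‖x‖ ^ 2) : ‖T‖ ≤ c := by
  have hc : 0 ≤ c := by
    obtain ⟨x, hx⟩ := exists_norm_eq H zero_le_one
    simpa [hx] using (norm_nonneg _).trans (h x)
  rw [T.norm_eq_iSup_rayleighQuotient hT.isSymmetric]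
  refine ciSup_le fun x => ?_
  rw [rayleighQuotient, abs_div, abs_sq]
  refine div_le_of_le_mul₀ (by positivity) hc ((RCLike.abs_re_le_norm _).trans ?_)
  rw [norm_inner_symm]
  exact h x

theorem norm_inner_adjoint (A : H →L[ℂ] H) (x : H) :
    ‖⟪x, adjoint A x⟫‖ = ‖⟪x, A x⟫‖ := by
  rw [adjoint_inner_right, norm_inner_symm]

theorem norm_reOp_le_numRadius (A : H →L[ℂ] H) : ‖reOp A‖ ≤ numRadius A := by
  refine norm_le_of_norm_inner_le (isSelfAdjoint_reOp A) fun x => ?_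
  refine le_trans ?_ (norm_inner_le_numRadius A x)
  have h := norm_add_le ⟪x, A x⟫ ⟪x, adjoint A x⟫
  rw [norm_inner_adjoint] at h
  simp only [reOp, smul_apply, add_apply, inner_smul_right, inner_add_right, norm_mul, norm_inv,
    Complex.norm_ofNat]
  linarith

theorem norm_imOp_le_numRadius (A : H →L[ℂ] H) : ‖imOp A‖ ≤ numRadius A := by
  refine norm_le_of_norm_inner_le (isSelfAdjoint_imOp A) fun x => ?_
  refine le_trans ?_ (norm_inner_le_numRadius A x)
  have h := norm_sub_le ⟪x, A x⟫ ⟪x, adjoint A x⟫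
  rw [norm_inner_adjoint] at h
  simp only [imOp, smul_apply, sub_apply, inner_smul_right, inner_sub_right, norm_mul, norm_inv,
    Complex.norm_ofNat, Complex.norm_I, mul_one]
  linarith

theorem reOp_add_I_smul_imOp (A : H →L[ℂ] H) (x : H) :
    reOp A x + Complex.I • imOp A x = A x := by
  simp only [reOp, imOp, smul_apply, add_apply, sub_apply]
  match_scalars <;> field_simp <;> norm_num

theorem reOp_sub_I_smul_imOp (A : H →L[ℂ] H) (x : H) :
    reOp A x - Complex.I • imOp A x = adjoint A x := by
  simp only [reOp, imOp, smul_apply, add_apply, sub_apply]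
  match_scalars <;> field_simp <;> norm_num

theorem reOp_comp_self (A : H →L[ℂ] H) (x : H) :
    reOp (A ∘L A) x = reOp A (reOp A x) - imOp A (imOp A x) := by
  simp only [reOp, imOp, smul_apply, add_apply, sub_apply, adjoint_comp, comp_apply, map_smul,
    map_add, map_sub]
  match_scalars <;> field_simp <;> norm_num

theorem norm_sq_add_norm_adjoint_sq (A : H →L[ℂ] H) (x : H) :
    ‖A x‖ ^ 2 + ‖adjoint A x‖ ^ 2 = 2 * (‖reOp A x‖ ^ 2 + ‖imOp A x‖ ^ 2) := by
  have h := parallelogram_law_with_norm ℂ (reOp A x) (Complex.I • imOp A x)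
  rwa [reOp_add_I_smul_imOp, reOp_sub_I_smul_imOp, norm_smul, Complex.norm_I, one_mul] at h

theorem inner_apply_apply_self {T : H →L[ℂ] H} (hT : IsSelfAdjoint T) (x : H) :
    ⟪x, T (T x)⟫ = ((‖T x‖ ^ 2 : ℝ) : ℂ) := by
  rw [← adjoint_inner_left, hT.adjoint_eq, inner_self_eq_norm_sq_to_K]
  simp

theorem norm_apply_apply_sq_le (T : H →L[ℂ] H) {x : H} (hx : ‖x‖ = 1) :
    ‖T (T x)‖ ^ 2 ≤ ‖T‖ ^ 4 := by
  have h : ‖T (T x)‖ ≤ ‖T‖ ^ 2 := by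
    calc ‖T (T x)‖ ≤ ‖T‖ * ‖T x‖ := T.le_opNorm _
      _ ≤ ‖T‖ * (‖T‖ * ‖x‖) := by gcongr; exact T.le_opNorm x
      _ = ‖T‖ ^ 2 := by rw [hx]; ring
  calc ‖T (T x)‖ ^ 2 ≤ (‖T‖ ^ 2) ^ 2 := by gcongr
    _ = ‖T‖ ^ 4 := by ring

theorem norm_add_norm_adjoint_pow_four_le (A : H →L[ℂ] H) {x : H} (hx : ‖x‖ = 1) :
    (‖A x‖ + ‖adjoint A x‖) ^ 4 ≤
      64 * (numRadius A ^ 4 - (1 / 4) * crawford (reOp (A ∘L A) ^ 2) -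
        (1 / 2) * |‖reOp A‖ ^ 4 - ‖imOp A‖ ^ 4|) := by
  set P := reOp A
  set Q := imOp A
  have hcraw : crawford (reOp (A ∘L A) ^ 2) ≤ ‖P (P x) - Q (Q x)‖ ^ 2 := by
    refine (crawford_le _ hx).trans_eq ?_
    rw [pow_two, mul_apply_eq_comp, inner_apply_apply_self (isSelfAdjoint_reOp _), reOp_comp_self,
      Complex.norm_real, Real.norm_of_nonneg (by positivity)]
  have hpar := parallelogram_law_with_norm ℂ (P (P x)) (Q (Q x))
  have hinner : ‖P x‖ ^ 2 + ‖Q x‖ ^ 2 ≤ ‖P (P x) + Q (Q x)‖ := by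
    have h := norm_inner_le_norm (𝕜 := ℂ) x (P (P x) + Q (Q x))
    rw [inner_add_right, inner_apply_apply_self (isSelfAdjoint_reOp A),
      inner_apply_apply_self (isSelfAdjoint_imOp A), ← Complex.ofReal_add, Complex.norm_real,
      Real.norm_of_nonneg (by positivity), hx, one_mul] at h
    exact h
  have hsq : (‖A x‖ + ‖adjoint A x‖) ^ 2 ≤ 4 * ‖P (P x) + Q (Q x)‖ := by
    linarith [add_sq_le (a := ‖A x‖) (b := ‖adjoint A x‖), norm_sq_add_norm_adjoint_sq A x]
  have hfour : (‖A x‖ + ‖adjoint A x‖) ^ 4 ≤ 16 * ‖P (P x) + Q (Q x)‖ ^ 2 := by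
    have h := pow_le_pow_left₀ (by positivity) hsq 2
    linarith
  have hP := norm_apply_apply_sq_le P hx
  have hQ := norm_apply_apply_sq_le Q hx
  have hPw : ‖P‖ ^ 4 ≤ numRadius A ^ 4 := by gcongr; exact norm_reOp_le_numRadius A
  have hQw : ‖Q‖ ^ 4 ≤ numRadius A ^ 4 := by gcongr; exact norm_imOp_le_numRadius A
  rcases abs_cases (‖P‖ ^ 4 - ‖Q‖ ^ 4) with ⟨h, -⟩ | ⟨h, -⟩ <;> rw [h] <;> linarith

theorem le_two_sqrt_two_mul_rpow {s K : ℝ} (hs : 0 ≤ s) (h : s ^ 4 ≤ 64 * K) :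
    s ≤ 2 * Real.sqrt 2 * K ^ ((1 : ℝ) / 4) := by
  have hK : 0 ≤ K := by linarith [pow_nonneg hs 4]
  refine le_of_pow_le_pow_left₀ four_ne_zero (by positivity) (h.trans_eq ?_)
  have h1 : (K ^ ((1 : ℝ) / 4)) ^ 4 = K := by
    rw [← Real.rpow_natCast, ← Real.rpow_mul hK]
    norm_num
  have h2 : Real.sqrt 2 ^ 4 = 4 := by
    rw [show 4 = 2 * 2 from rfl, pow_mul, Real.sq_sqrt zero_le_two]
    norm_num
  rw [mul_pow, mul_pow, h1, h2]
  norm_num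

theorem norm_inner_comp_add_norm_inner_comp_le (A B : H →L[ℂ] H) {x : H} (hx : ‖x‖ = 1) :
    ‖⟪x, A (B x)⟫‖ + ‖⟪x, B (A x)⟫‖ ≤ ‖B‖ * (‖A x‖ + ‖adjoint A x‖) := by
  have hB : ‖B x‖ ≤ ‖B‖ := by simpa [hx] using B.le_opNorm x
  have h1 : ‖⟪x, A (B x)⟫‖ ≤ ‖adjoint A x‖ * ‖B‖ := by
    rw [← adjoint_inner_left]
    exact (norm_inner_le_norm _ _).trans (by gcongr)
  have h2 : ‖⟪x, B (A x)⟫‖ ≤ ‖B‖ * ‖A x‖ := by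
    refine (norm_inner_le_norm _ _).trans ?_
    rw [hx, one_mul]
    exact B.le_opNorm _
  linarith

/-- For `A, B ∈ B(H)`,
`w(AB ± BA) ≤ 2√2·‖B‖·(w(A)⁴ − (1/4)c((Re(A²))²) − (1/2)|‖Re A‖⁴ − ‖Im A‖⁴|)^{1/4}`. -/
theorem stmt19 (A B : H →L[ℂ] H) :
    numRadius (A ∘L B + B ∘L A) ≤
        2 * Real.sqrt 2 * ‖B‖ *
          (numRadius A ^ 4 - (1 / 4) * crawford (reOp (A ∘L A) ^ 2) -
            (1 / 2) * |‖reOp A‖ ^ 4 - ‖imOp A‖ ^ 4|) ^ ((1 : ℝ) / 4) ∧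
      numRadius (A ∘L B - B ∘L A) ≤
        2 * Real.sqrt 2 * ‖B‖ *
          (numRadius A ^ 4 - (1 / 4) * crawford (reOp (A ∘L A) ^ 2) -
            (1 / 2) * |‖reOp A‖ ^ 4 - ‖imOp A‖ ^ 4|) ^ ((1 : ℝ) / 4) := by
  have key : ∀ x : H, ‖x‖ = 1 → ‖⟪x, A (B x)⟫‖ + ‖⟪x, B (A x)⟫‖ ≤
      2 * Real.sqrt 2 * ‖B‖ *
        (numRadius A ^ 4 - (1 / 4) * crawford (reOp (A ∘L A) ^ 2) -
          (1 / 2) * |‖reOp A‖ ^ 4 - ‖imOp A‖ ^ 4|) ^ ((1 : ℝ) / 4) := fun x hx => by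
    refine (norm_inner_comp_add_norm_inner_comp_le A B hx).trans ?_
    rw [mul_right_comm, mul_comm _ ‖B‖]
    gcongr
    exact le_two_sqrt_two_mul_rpow (by positivity) (norm_add_norm_adjoint_pow_four_le A hx)
  refine ⟨numRadius_le fun x hx => le_trans ?_ (key x hx),
    numRadius_le fun x hx => le_trans ?_ (key x hx)⟩
  · rw [add_apply, inner_add_right]
    exact norm_add_le _ _
  · rw [sub_apply, inner_sub_right]
    exact norm_sub_le _ _
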